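/- Let 1 ≤ q ≤ 2, 1 ≤ p ≤ 2, and let (Ω,ν) be a measure space. There is a constant C = C(p,q) such that for every n ∈ ℕ, every t > 0, and all functions f_1,…,f_n : {-1,1}^n → L^q(ν), one has E_ε‖Σ_{i=1}^n D_i P_t f_i(ε)‖_{L^q(ν)}^p ≤ C · (e^{2t}−1)^{-p/2} · E_{δ,ε}‖Σ_{i=1}^n δ_i D_i f_i(ε)‖_{L^q(ν)}^p. -/

import Mathlib

open scoped BigOperators
open Finset

noncomputable section

/-- The ±1 value of a Boolean coordinate. -/
def rad (b : Bool) : ℝ := if b then 1 else -1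

/-- Expectation over the uniform measure on the discrete cube `{-1,1}^n`
(points encoded as `Fin n → Bool`). -/
def cubeAvg {n : ℕ} {X : Type*} [AddCommGroup X] [Module ℝ X]
    (f : (Fin n → Bool) → X) : X :=
  ((2 ^ n : ℝ)⁻¹) • ∑ ε : Fin n → Bool, f ε

/-- Walsh character `w_A(ε) = ∏_{i ∈ A} ε_i`. -/
def walshChar {n : ℕ} (A : Finset (Fin n)) (ε : Fin n → Bool) : ℝ :=
  ∏ i ∈ A, rad (ε i)

/-- Walsh coefficient `f̂(A) = E_ε [f(ε) w_A(ε)]`. -/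
def wcoef {n : ℕ} {X : Type*} [AddCommGroup X] [Module ℝ X]
    (f : (Fin n → Bool) → X) (A : Finset (Fin n)) : X :=
  cubeAvg (fun ε => walshChar A ε • f ε)

/-- Flip the `j`-th coordinate. -/
def flipCoord {n : ℕ} (j : Fin n) (ε : Fin n → Bool) : Fin n → Bool :=
  Function.update ε j (!(ε j))

/-- Discrete derivative `D_j f(ε) = (f(ε) - f(σ_j ε))/2`. -/
def Dop {n : ℕ} {X : Type*} [AddCommGroup X] [Module ℝ X]
    (j : Fin n) (f : (Fin n → Bool) → X) : (Fin n → Bool) → X :=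
  fun ε => (2 : ℝ)⁻¹ • (f ε - f (flipCoord j ε))

/-- Heat semigroup `P_t f = Σ_A e^{-t|A|} f̂(A) w_A`. -/
def heatOp {n : ℕ} {X : Type*} [AddCommGroup X] [Module ℝ X]
    (t : ℝ) (f : (Fin n → Bool) → X) : (Fin n → Bool) → X :=
  fun ε => ∑ A : Finset (Fin n), (Real.exp (-t * A.card) * walshChar A ε) • wcoef f A

/-- Fractional power of the Laplacian on mean-zero parts:
`Δ^a f = Σ_{A ≠ ∅} |A|^a f̂(A) w_A`. -/
def lapPow {n : ℕ} {X : Type*} [AddCommGroup X] [Module ℝ X]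
    (a : ℝ) (f : (Fin n → Bool) → X) : (Fin n → Bool) → X :=
  fun ε => ∑ A ∈ Finset.univ.filter (fun A : Finset (Fin n) => A ≠ ∅),
    (((A.card : ℝ)) ^ a * walshChar A ε) • wcoef f A

/-- `X` has cotype `q` with constant `K`. -/
def HasCotypeConst (X : Type*) [NormedAddCommGroup X] [NormedSpace ℝ X] (q K : ℝ) : Prop :=
  ∀ m : ℕ, ∀ x : Fin m → X,
    (∑ j, ‖x j‖ ^ q) ^ (1 / q) ≤
      K * (cubeAvg (fun δ : Fin m → Bool => ‖∑ j, rad (δ j) • x j‖ ^ (2 : ℝ))) ^ (1 / 2 : ℝ)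

/-- `X` has type `s` with constant `T`. -/
def HasTypeConst (X : Type*) [NormedAddCommGroup X] [NormedSpace ℝ X] (s T : ℝ) : Prop :=
  ∀ m : ℕ, ∀ x : Fin m → X,
    (cubeAvg (fun δ : Fin m → Bool => ‖∑ j, rad (δ j) • x j‖ ^ (2 : ℝ))) ^ (1 / 2 : ℝ) ≤
      T * (∑ j, ‖x j‖ ^ s) ^ (1 / s)

/-! ### Product weights on the cube -/

lemma sum_cube_succ {n : ℕ} {X : Type*} [AddCommMonoid X] (F : (Fin (n + 1) → Bool) → X) :
    ∑ ξ, F ξ = ∑ ξ : Fin n → Bool, F (Fin.cons true ξ) + ∑ ξ : Fin n → Bool, F (Fin.cons false ξ) := by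
  rw [← (Fin.consEquiv (fun _ => Bool)).sum_comp F, Fintype.sum_prod_type]
  simp [Fin.consEquiv]

/-- Expectation with respect to a product weight. -/
def wE {n : ℕ} (w : Bool → ℝ) (F : (Fin n → Bool) → ℝ) : ℝ :=
  ∑ ξ : Fin n → Bool, (∏ i, w (ξ i)) * F ξ

lemma wE_succ {n : ℕ} (w : Bool → ℝ) (F : (Fin (n + 1) → Bool) → ℝ) :
    wE w F = w true * wE w (fun ξ : Fin n → Bool => F (Fin.cons true ξ))
      + w false * wE w (fun ξ : Fin n → Bool => F (Fin.cons false ξ)) := by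
  simp only [wE, sum_cube_succ, Fin.prod_univ_succ, Fin.cons_zero, Fin.cons_succ, mul_sum, mul_assoc]

lemma wE_add {n : ℕ} (w : Bool → ℝ) (F G : (Fin n → Bool) → ℝ) :
    wE w (fun ξ => F ξ + G ξ) = wE w F + wE w G := by
  simp [wE, mul_add, sum_add_distrib]

lemma wE_const_mul {n : ℕ} (w : Bool → ℝ) (c : ℝ) (F : (Fin n → Bool) → ℝ) :
    wE w (fun ξ => c * F ξ) = c * wE w F := by
  simp only [wE, mul_sum]
  exact sum_congr rfl fun _ _ => by ring

lemma wE_const {n : ℕ} (w : Bool → ℝ) (hw : w true + w false = 1) (c : ℝ) :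
    wE w (fun _ : Fin n → Bool => c) = c := by
  induction n with
  | zero => simp [wE]
  | succ n ih => rw [wE_succ, ih, ← add_mul, hw, one_mul]

lemma wE_one {n : ℕ} (w : Bool → ℝ) (hw : w true + w false = 1) :
    ∑ ξ : Fin n → Bool, (∏ i, w (ξ i)) = 1 := by
  simpa [wE] using wE_const (n := n) w hw 1

lemma wE_sq {n : ℕ} (w h : Bool → ℝ) (hw : w true + w false = 1)
    (h1 : w true * h true + w false * h false = 0) (v : ℝ)
    (h2 : w true * h true ^ 2 + w false * h false ^ 2 = v) (a : Fin n → ℝ) :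
    wE w (fun ξ : Fin n → Bool => (∑ i, h (ξ i) * a i) ^ 2) = v * ∑ i, a i ^ 2 := by
  induction n with
  | zero => simp [wE]
  | succ n ih =>
    have key : ∀ b : Bool, wE w (fun ξ : Fin n → Bool => (h b * a 0 + ∑ i, h (ξ i) * a i.succ) ^ 2)
        = h b ^ 2 * a 0 ^ 2 + (2 * h b * a 0) * wE w (fun ξ : Fin n → Bool => ∑ i, h (ξ i) * a i.succ)
          + v * ∑ i : Fin n, a i.succ ^ 2 := by
      intro b
      rw [← ih (fun i => a i.succ), ← wE_const_mul, ← wE_const (n := n) w hw (h b ^ 2 * a 0 ^ 2), ← wE_add, ← wE_add]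
      congr 1; funext ξ; try rw [wE_const w hw]
      ring
    rw [wE_succ]
    simp only [Fin.sum_univ_succ, Fin.cons_zero, Fin.cons_succ, key]
    generalize wE w (fun ξ : Fin n → Bool => ∑ i, h (ξ i) * a i.succ) = M
    generalize ∑ i : Fin n, a i.succ ^ 2 = S
    linear_combination (a 0 ^ 2) * h2 + 2 * a 0 * M * h1 + v * S * hw

/-- The uniform weight. -/
def half : Bool → ℝ := fun _ => 2⁻¹

lemma half_sum : half true + half false = 1 := by norm_num [half]

lemma wE_four {n : ℕ} (a : Fin n → ℝ) :
    wE half (fun ξ : Fin n → Bool => (∑ i, rad (ξ i) * a i) ^ 4) ≤ 3 * (∑ i, a i ^ 2) ^ 2 := by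
  induction n with
  | zero => simp [wE]
  | succ n ih =>
    have key : ∀ b : Bool, wE half (fun ξ : Fin n → Bool => (rad b * a 0 + ∑ i, rad (ξ i) * a i.succ) ^ 4)
        = a 0 ^ 4 + (4 * rad b * a 0 ^ 3) * wE half (fun ξ : Fin n → Bool => ∑ i, rad (ξ i) * a i.succ)
          + (6 * a 0 ^ 2) * wE half (fun ξ : Fin n → Bool => (∑ i, rad (ξ i) * a i.succ) ^ 2)
          + (4 * rad b * a 0) * wE half (fun ξ : Fin n → Bool => (∑ i, rad (ξ i) * a i.succ) ^ 3)
          + wE half (fun ξ : Fin n → Bool => (∑ i, rad (ξ i) * a i.succ) ^ 4) := by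
      intro b
      rw [← wE_const_mul, ← wE_const_mul, ← wE_const_mul,
        ← wE_const (n := n) half half_sum (a 0 ^ 4), ← wE_add, ← wE_add, ← wE_add, ← wE_add]
      congr 1; funext ξ; try rw [wE_const half half_sum]
      cases b <;> simp only [rad, if_true, if_false, Bool.false_eq_true] <;> ring
    have h2 := wE_sq half rad half_sum (by norm_num [half, rad]) 1 (by norm_num [half, rad]) (fun i : Fin n => a i.succ)
    rw [wE_succ]
    simp only [Fin.sum_univ_succ, Fin.cons_zero, Fin.cons_succ, key, h2]
    have := ih (fun i => a i.succ)
    generalize wE half (fun ξ : Fin n → Bool => ∑ i, rad (ξ i) * a i.succ) = M1 at *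
    generalize wE half (fun ξ : Fin n → Bool => (∑ i, rad (ξ i) * a i.succ) ^ 3) = M3 at *
    generalize wE half (fun ξ : Fin n → Bool => (∑ i, rad (ξ i) * a i.succ) ^ 4) = M4 at *
    generalize ∑ i : Fin n, a i.succ ^ 2 = S at *
    simp only [half, rad, if_true, if_false, Bool.false_eq_true]
    nlinarith [sq_nonneg (a 0 ^ 2)]

lemma cubeAvg_eq_wE {n : ℕ} (F : (Fin n → Bool) → ℝ) : cubeAvg F = wE half F := by
  simp [cubeAvg, wE, half, mul_sum]

/-- Khinchine's inequality, L¹ version. -/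
lemma khinchine {n : ℕ} (a : Fin n → ℝ) :
    ∑ i, a i ^ 2 ≤ (9 / 5 * cubeAvg (fun δ : Fin n → Bool => |∑ i, rad (δ i) * a i|)) ^ 2 := by
  set S := ∑ i, a i ^ 2 with hS
  have hS0 : 0 ≤ S := sum_nonneg fun _ _ => sq_nonneg _
  rcases hS0.eq_or_lt with h | h
  · rw [← h]; positivity
  set s := Real.sqrt S
  have hs : 0 < s := Real.sqrt_pos.2 h
  have hss : s ^ 2 = S := Real.sq_sqrt hS0
  have h2 := wE_sq half rad half_sum (by norm_num [half, rad]) 1 (by norm_num [half, rad]) a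
  have h4 := wE_four a
  rw [← hS] at h2 h4
  have pt : ∀ y : ℝ, s ^ 2 * y ^ 2 + (-(4 / 27)) * y ^ 4 ≤ s ^ 3 * |y| := by
    intro y
    have e2 : y ^ 2 = |y| ^ 2 := (sq_abs y).symm
    have e4 : y ^ 4 = |y| ^ 4 := by rw [show y ^ 4 = (y ^ 2) ^ 2 by ring, e2]; ring
    rw [e2, e4]
    have hz := abs_nonneg y
    generalize |y| = z at hz
    have : 0 ≤ z * ((z - 3 / 2 * s) ^ 2 * (z + 3 * s)) := by positivity
    nlinarith
  have := wE_add half (fun ξ : Fin n → Bool => s ^ 2 * (∑ i, rad (ξ i) * a i) ^ 2)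
    (fun ξ => (-(4 / 27)) * (∑ i, rad (ξ i) * a i) ^ 4)
  rw [wE_const_mul, wE_const_mul, h2] at this
  have mono : wE half (fun ξ : Fin n → Bool => s ^ 2 * (∑ i, rad (ξ i) * a i) ^ 2 + (-(4 / 27)) * (∑ i, rad (ξ i) * a i) ^ 4)
      ≤ wE half (fun ξ : Fin n → Bool => s ^ 3 * |∑ i, rad (ξ i) * a i|) := by
    refine sum_le_sum fun ξ _ => mul_le_mul_of_nonneg_left (pt _) (prod_nonneg fun _ _ => by norm_num [half])
  rw [this, wE_const_mul, ← cubeAvg_eq_wE (fun ξ : Fin n → Bool => |∑ i, rad (ξ i) * a i|)] at mono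
  set M := cubeAvg (fun δ : Fin n → Bool => |∑ i, rad (δ i) * a i|)
  have h5 : s ^ 3 * (5 / 9 * s) ≤ s ^ 3 * M := by
    rw [← hss] at mono h4
    nlinarith
  have h6 := le_of_mul_le_mul_left h5 (by positivity)
  rw [← hss]
  exact pow_le_pow_left₀ hs.le (by linarith) 2

/-! ### Heat kernel -/

/-- Pointwise product of two sign vectors. -/
def xm {n : ℕ} (ε ξ : Fin n → Bool) : Fin n → Bool := fun i => ε i == ξ i

lemma xm_xm {n : ℕ} (ε ξ : Fin n → Bool) : xm ε (xm ε ξ) = ξ := by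
  funext i; simp only [xm]; cases ε i <;> cases ξ i <;> rfl

lemma xm_comm {n : ℕ} (ε ξ : Fin n → Bool) : xm ε ξ = xm ξ ε := by
  funext i; simp only [xm]; cases ε i <;> cases ξ i <;> rfl

/-- Multiplication by a sign vector, as an equivalence. -/
def xmE {n : ℕ} (ε : Fin n → Bool) : (Fin n → Bool) ≃ (Fin n → Bool) :=
  ⟨xm ε, xm ε, xm_xm ε, xm_xm ε⟩

lemma flipCoord_flipCoord {n : ℕ} (j : Fin n) (ξ : Fin n → Bool) : flipCoord j (flipCoord j ξ) = ξ := by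
  funext i; by_cases h : i = j <;> simp [flipCoord, h]

/-- Flipping, as an equivalence. -/
def flE {n : ℕ} (j : Fin n) : (Fin n → Bool) ≃ (Fin n → Bool) :=
  ⟨flipCoord j, flipCoord j, flipCoord_flipCoord j, flipCoord_flipCoord j⟩

lemma xm_flip_left {n : ℕ} (j : Fin n) (ε ξ : Fin n → Bool) :
    xm (flipCoord j ε) ξ = flipCoord j (xm ε ξ) := by
  funext i
  by_cases h : i = j
  · subst h; simp only [xm, flipCoord, Function.update_self]; cases ε i <;> cases ξ i <;> rfl
  · simp [xm, flipCoord, h]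

lemma xm_flip_right {n : ℕ} (j : Fin n) (ε ξ : Fin n → Bool) :
    xm ε (flipCoord j ξ) = flipCoord j (xm ε ξ) := by
  rw [xm_comm, xm_flip_left, xm_comm]

/-- One-coordinate heat kernel. -/
def hk (ρ : ℝ) (b : Bool) : ℝ := (1 + ρ * rad b) / 2

lemma hk_sum (ρ : ℝ) : hk ρ true + hk ρ false = 1 := by simp [hk, rad]; ring

lemma rad_beq (a b : Bool) : rad (a == b) = rad a * rad b := by
  cases a <;> cases b <;> simp [rad]

lemma heatOp_eq {n : ℕ} {X : Type*} [AddCommGroup X] [Module ℝ X] (t : ℝ)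
    (f : (Fin n → Bool) → X) (ε : Fin n → Bool) :
    heatOp t f ε = ∑ ξ : Fin n → Bool, (∏ i, hk (Real.exp (-t)) (ξ i)) • f (xm ε ξ) := by
  rw [← (xmE ε).sum_comp]
  simp only [xmE, Equiv.coe_fn_mk, xm_xm]
  simp only [heatOp, wcoef, cubeAvg, smul_sum, smul_smul]
  rw [sum_comm]
  refine sum_congr rfl fun ξ _ => ?_
  rw [← sum_smul]
  congr 1
  have : ∏ i, hk (Real.exp (-t)) (xm ε ξ i)
      = (2 ^ n : ℝ)⁻¹ * ∏ i, (1 + Real.exp (-t) * (rad (ε i) * rad (ξ i))) := by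
    simp only [hk, xm, rad_beq, div_eq_inv_mul, prod_mul_distrib]
    simp
  rw [this, prod_one_add, mul_sum, powerset_univ]
  refine sum_congr rfl fun A _ => ?_
  rw [prod_mul_distrib, prod_mul_distrib, prod_const, ← Real.exp_nat_mul, walshChar, walshChar]
  rw [mul_comm (-t)]
  ring_nf

lemma Dop_heatOp {n : ℕ} {X : Type*} [AddCommGroup X] [Module ℝ X] (t : ℝ) (j : Fin n)
    (f : (Fin n → Bool) → X) (ε : Fin n → Bool) :
    Dop j (heatOp t f) ε = ∑ ξ : Fin n → Bool, (∏ i, hk (Real.exp (-t)) (ξ i)) • Dop j f (xm ε ξ) := by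
  simp only [Dop, heatOp_eq, xm_flip_left]
  rw [← sum_sub_distrib, smul_sum]
  refine sum_congr rfl fun ξ _ => ?_
  rw [← smul_sub, smul_comm]

lemma Dop_flip {n : ℕ} {X : Type*} [AddCommGroup X] [Module ℝ X] (j : Fin n)
    (f : (Fin n → Bool) → X) (ε : Fin n → Bool) : Dop j f (flipCoord j ε) = - Dop j f ε := by
  simp only [Dop, flipCoord_flipCoord]
  rw [← smul_neg, neg_sub]

lemma odd_sum {n : ℕ} {X : Type*} [AddCommGroup X] [Module ℝ X] (j : Fin n)
    (g : (Fin n → Bool) → X) (hg : ∀ ξ, g (flipCoord j ξ) = - g ξ) (u : (Fin n → Bool) → ℝ) :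
    (2 : ℝ) • ∑ ξ, u ξ • g ξ = ∑ ξ, (u ξ - u (flipCoord j ξ)) • g ξ := by
  have h : ∑ ξ, u ξ • g ξ = ∑ ξ, (- u (flipCoord j ξ)) • g ξ := by
    rw [← (flE j).sum_comp]
    simp [flE, hg]
  rw [two_smul]
  nth_rewrite 2 [h]
  rw [← sum_add_distrib]
  exact sum_congr rfl fun ξ _ => by rw [← add_smul, sub_eq_add_neg]

lemma Dop_heatOp' {n : ℕ} {X : Type*} [AddCommGroup X] [Module ℝ X] (t : ℝ) (ρ : ℝ)
    (hρ : ρ = Real.exp (-t)) (h1 : 1 - ρ ^ 2 ≠ 0) (j : Fin n)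
    (f : (Fin n → Bool) → X) (ε : Fin n → Bool) :
    Dop j (heatOp t f) ε = ∑ ξ : Fin n → Bool, (∏ i, hk ρ (ξ i)) •
      ((ρ / (1 - ρ ^ 2)) • ((rad (ξ j) - ρ) • Dop j f (xm ε ξ))) := by
  rw [Dop_heatOp, ← hρ]
  simp only [smul_smul]
  have hg : ∀ ξ, Dop j f (xm ε (flipCoord j ξ)) = - Dop j f (xm ε ξ) := by
    intro ξ; rw [xm_flip_right, Dop_flip]
  have two : Function.Injective (fun x : X => (2 : ℝ) • x) := by
    intro x y hxy
    have := congrArg (fun z => (2 : ℝ)⁻¹ • z) hxy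
    simpa [smul_smul] using this
  apply two
  simp only
  rw [odd_sum j _ hg, odd_sum j (fun ξ => Dop j f (xm ε ξ)) hg
    (fun ξ => (∏ i, hk ρ (ξ i)) * (ρ / (1 - ρ ^ 2) * (rad (ξ j) - ρ)))]
  refine sum_congr rfl fun ξ _ => ?_
  congr 1
  have e1 : ∏ i, hk ρ (ξ i) = hk ρ (ξ j) * ∏ i ∈ univ.erase j, hk ρ (ξ i) :=
    (mul_prod_erase univ _ (mem_univ j)).symm
  have e2 : ∏ i, hk ρ (flipCoord j ξ i) = hk ρ (!(ξ j)) * ∏ i ∈ univ.erase j, hk ρ (ξ i) := by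
    rw [← mul_prod_erase univ _ (mem_univ j)]
    congr 1
    · simp [flipCoord]
    · refine prod_congr rfl fun i hi => ?_
      simp [flipCoord, (mem_erase.1 hi).1]
  have e3 : flipCoord j ξ j = !(ξ j) := by simp [flipCoord]
  rw [e1, e2, e3]
  cases ξ j <;> simp only [hk, rad, Bool.not_true, Bool.not_false, if_true, if_false, Bool.false_eq_true] <;> field_simp <;> ring

/-! ### Minkowski -/

open MeasureTheory in
lemma Lp_norm_rpow {Ω : Type*} [MeasurableSpace Ω] {ν : Measure Ω} (q : ℝ) (hq1 : 1 ≤ q)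
    [Fact (1 ≤ ENNReal.ofReal q)] (x : Lp ℝ (ENNReal.ofReal q) ν) :
    Integrable (fun ω => |x ω| ^ q) ν ∧ ‖x‖ ^ q = ∫ ω, |x ω| ^ q ∂ν := by
  have h0 : ENNReal.ofReal q ≠ 0 := by
    rw [Ne, ENNReal.ofReal_eq_zero]; linarith
  have hr : (ENNReal.ofReal q).toReal = q := ENNReal.toReal_ofReal (by linarith)
  have hx := Lp.memLp x
  constructor
  · have := hx.integrable_norm_rpow h0 ENNReal.ofReal_ne_top
    simpa [hr] using this
  · rw [Lp.norm_def, hx.eLpNorm_eq_integral_rpow_norm h0 ENNReal.ofReal_ne_top, hr,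
      ENNReal.toReal_ofReal (by positivity), Real.rpow_inv_rpow (by positivity) (by linarith)]
    simp

open MeasureTheory in
lemma mink {Ω : Type*} [MeasurableSpace Ω] {ν : Measure Ω} (q : ℝ) (hq1 : 1 ≤ q) (hq2 : q ≤ 2)
    [Fact (1 ≤ ENNReal.ofReal q)] {ι : Type*} [Fintype ι] (W : ι → ℝ) (hW : ∀ i, 0 ≤ W i)
    (Y : ι → Lp ℝ (ENNReal.ofReal q) ν) (T : Lp ℝ (ENNReal.ofReal q) ν)
    (h : ∀ᵐ ω ∂ν, ∑ i, W i * (Y i ω) ^ 2 ≤ (T ω) ^ 2) :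
    ∑ i, W i * ‖Y i‖ ^ 2 ≤ ‖T‖ ^ 2 := by
  have hq0 : 0 < q := by linarith
  set r : ENNReal := ENNReal.ofReal (2 / q) with hr
  have hr1 : (1 : ℝ) ≤ 2 / q := by rw [le_div_iff₀ hq0]; linarith
  have : Fact (1 ≤ r) := ⟨by rw [hr]; simpa using hr1⟩
  have hrr : r.toReal = 2 / q := ENNReal.toReal_ofReal (by positivity)
  have pw : ∀ i, ∀ y : ℝ, 0 ≤ y → ‖(W i) ^ (q / 2) * y ^ q‖ ^ (2 / q) = W i * y ^ 2 := by
    intro i y hy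
    rw [Real.norm_of_nonneg (mul_nonneg (Real.rpow_nonneg (hW i) _) (Real.rpow_nonneg hy _)),
      Real.mul_rpow (Real.rpow_nonneg (hW i) _) (Real.rpow_nonneg hy _), ← Real.rpow_mul (hW i),
      ← Real.rpow_mul hy, show q / 2 * (2 / q) = 1 by field_simp,
      show q * (2 / q) = ((2 : ℕ) : ℝ) by push_cast; field_simp, Real.rpow_one, Real.rpow_natCast]
  let g : Ω → PiLp r (fun _ : ι => ℝ) := fun ω => WithLp.toLp r (fun i => (W i) ^ (q / 2) * |Y i ω| ^ q)
  have hgi : ∀ i, Integrable (fun ω => g ω i) ν := fun i =>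
    ((Lp_norm_rpow q hq1 (Y i)).1).const_mul _
  have hint : ∀ i, (∫ ω, g ω ∂ν) i = (W i) ^ (q / 2) * ‖Y i‖ ^ q := by
    intro i
    rw [eval_integral_piLp hgi, (Lp_norm_rpow q hq1 (Y i)).2, ← integral_const_mul]
  have hn1 : ‖∫ ω, g ω ∂ν‖ = (∑ i, W i * ‖Y i‖ ^ 2) ^ (q / 2) := by
    rw [PiLp.norm_eq_sum (by rw [hrr]; positivity), hrr]
    simp only [hint, pw _ _ (norm_nonneg _)]
    congr 1; field_simp
  have hn2 : ∀ ω, ‖g ω‖ = (∑ i, W i * (Y i ω) ^ 2) ^ (q / 2) := by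
    intro ω
    rw [PiLp.norm_eq_sum (by rw [hrr]; positivity), hrr]
    simp only [g, pw _ _ (abs_nonneg _), sq_abs]
    congr 1; field_simp
  have hA : 0 ≤ ∑ i, W i * ‖Y i‖ ^ 2 := sum_nonneg fun i _ => mul_nonneg (hW i) (sq_nonneg _)
  have main : (∑ i, W i * ‖Y i‖ ^ 2) ^ (q / 2) ≤ (‖T‖ ^ 2) ^ (q / 2) := by
    have e : (‖T‖ ^ 2) ^ (q / 2) = ‖T‖ ^ q := by
      rw [← Real.rpow_natCast, ← Real.rpow_mul (norm_nonneg _)]; congr 1; push_cast; ring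
    rw [e, (Lp_norm_rpow q hq1 T).2, ← hn1]
    refine (norm_integral_le_integral_norm _).trans (integral_mono_ae
      (Integrable.of_eval_piLp hgi).norm (Lp_norm_rpow q hq1 T).1 ?_)
    filter_upwards [h] with ω hω
    simp only [hn2]
    have e : |T ω| ^ q = ((T ω) ^ 2) ^ (q / 2) := by
      rw [← sq_abs (T ω), ← Real.rpow_natCast, ← Real.rpow_mul (abs_nonneg _)]; congr 1; push_cast; ring
    rw [e]
    exact Real.rpow_le_rpow (sum_nonneg fun i _ => mul_nonneg (hW i) (sq_nonneg _)) hω (by positivity)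
  exact (Real.rpow_le_rpow_iff hA (sq_nonneg _) (by positivity)).1 main

open MeasureTheory in
lemma Lp_coe_sum {Ω : Type*} [MeasurableSpace Ω] {ν : Measure Ω} {r : ENNReal}
    {ι : Type*} (s : Finset ι) (x : ι → Lp ℝ r ν) :
    ⇑(∑ i ∈ s, x i) =ᵐ[ν] fun ω => ∑ i ∈ s, x i ω := by
  classical
  induction s using Finset.induction_on with
  | empty =>
    simp only [sum_empty]
    exact Lp.coeFn_zero ℝ r ν
  | insert i s hi ih =>
    rw [sum_insert hi]
    filter_upwards [Lp.coeFn_add (x i) (∑ i ∈ s, x i), ih] with ω h1 h2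
    rw [h1, Pi.add_apply, h2, sum_insert hi]

open MeasureTheory in
lemma Lp_coe_lin {Ω : Type*} [MeasurableSpace Ω] {ν : Measure Ω} {r : ENNReal}
    {ι : Type*} [Fintype ι] (c : ι → ℝ) (x : ι → Lp ℝ r ν) :
    ⇑(∑ i, c i • x i) =ᵐ[ν] fun ω => ∑ i, c i * x i ω := by
  have h : ∀ᵐ ω ∂ν, ∀ i, (c i • x i) ω = c i * x i ω := by
    rw [ae_all_iff]; intro i
    filter_upwards [Lp.coeFn_smul (c i) (x i)] with ω hω
    rw [hω]; rfl
  filter_upwards [Lp_coe_sum univ (fun i => c i • x i), h] with ω h1 h2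
  rw [h1]; exact sum_congr rfl fun i _ => h2 i

open MeasureTheory in
lemma key_Lq {Ω : Type*} [MeasurableSpace Ω] {ν : Measure Ω} (q p : ℝ) (hq1 : 1 ≤ q) (hq2 : q ≤ 2)
    (hp1 : 1 ≤ p) (hp2 : p ≤ 2) [Fact (1 ≤ ENNReal.ofReal q)] {n : ℕ}
    (ρ : ℝ) (hρ0 : 0 ≤ ρ) (hρ1 : ρ ≤ 1) (x : Fin n → Lp ℝ (ENNReal.ofReal q) ν) :
    ∑ ξ : Fin n → Bool, (∏ i, hk ρ (ξ i)) * ‖∑ i, (rad (ξ i) - ρ) • x i‖ ^ p ≤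
      (9 / 5 * Real.sqrt (1 - ρ ^ 2)) ^ p *
        cubeAvg (fun δ : Fin n → Bool => ‖∑ i, rad (δ i) • x i‖ ^ p) := by
  have hk0 : ∀ b, 0 ≤ hk ρ b := by intro b; cases b <;> simp [hk, rad] <;> linarith
  set W : (Fin n → Bool) → ℝ := fun ξ => ∏ i, hk ρ (ξ i) with hWdef
  have hW : ∀ ξ, 0 ≤ W ξ := fun ξ => prod_nonneg fun i _ => hk0 _
  have hW1 : ∑ ξ, W ξ = 1 := wE_one _ (hk_sum ρ)
  set Y : (Fin n → Bool) → Lp ℝ (ENNReal.ofReal q) ν := fun ξ => ∑ i, (rad (ξ i) - ρ) • x i with hY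
  set Z : (Fin n → Bool) → Lp ℝ (ENNReal.ofReal q) ν := fun δ => ∑ i, rad (δ i) • x i with hZ
  set κ := 9 / 5 * Real.sqrt (1 - ρ ^ 2) with hκ
  have hρ2 : 0 ≤ 1 - ρ ^ 2 := by nlinarith
  have hκ0 : 0 ≤ κ := by positivity
  set T : Lp ℝ (ENNReal.ofReal q) ν := ∑ δ : Fin n → Bool, (κ * (2 ^ n : ℝ)⁻¹) • |Z δ| with hT
  have hpt : ∀ᵐ ω ∂ν, ∑ ξ, W ξ * (Y ξ ω) ^ 2 ≤ (T ω) ^ 2 := by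
    have hY' : ∀ᵐ ω ∂ν, ∀ ξ, Y ξ ω = ∑ i, (rad (ξ i) - ρ) * x i ω :=
      ae_all_iff.2 fun ξ => Lp_coe_lin _ _
    have hZ' : ∀ᵐ ω ∂ν, ∀ δ, Z δ ω = ∑ i, rad (δ i) * x i ω :=
      ae_all_iff.2 fun ξ => Lp_coe_lin _ _
    have hA' : ∀ᵐ ω ∂ν, ∀ δ, |Z δ| ω = |Z δ ω| :=
      ae_all_iff.2 fun ξ => Lp.coeFn_abs _
    filter_upwards [hY', hZ', hA', Lp_coe_lin (fun _ => κ * (2 ^ n : ℝ)⁻¹) (fun δ => |Z δ|)]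
      with ω h1 h2 h3 h4
    simp only [hT, h4, h3, h2, h1]
    have := wE_sq (hk ρ) (fun b => rad b - ρ) (hk_sum ρ) (by simp [hk, rad]; ring) (1 - ρ ^ 2)
      (by simp [hk, rad]; ring) (fun i => x i ω)
    rw [wE] at this
    rw [hWdef]
    simp only [this]
    have kh := khinchine (fun i => x i ω)
    rw [← mul_sum, mul_assoc]
    simp only [cubeAvg, smul_eq_mul] at kh
    calc _ ≤ (1 - ρ ^ 2) * _ := mul_le_mul_of_nonneg_left kh hρ2
      _ = _ := by
        rw [hκ]
        conv_lhs => rw [← Real.sq_sqrt hρ2]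
        ring
  have h2 := mink q hq1 hq2 W hW Y T hpt
  have hTn : ‖T‖ ≤ κ * cubeAvg (fun δ => ‖Z δ‖) := by
    refine (norm_sum_le _ _).trans (le_of_eq ?_)
    simp only [cubeAvg, smul_eq_mul, mul_sum]
    refine sum_congr rfl fun δ _ => ?_
    rw [norm_smul, norm_abs_eq_norm, Real.norm_of_nonneg (by positivity), mul_assoc]
  have hp0 : 0 < p := by linarith
  have hr1 : (1 : ℝ) ≤ 2 / p := by rw [le_div_iff₀ hp0]; linarith
  have j1 : (∑ ξ, W ξ * ‖Y ξ‖ ^ p) ^ (2 / p) ≤ ∑ ξ, W ξ * ‖Y ξ‖ ^ 2 := by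
    refine (Real.rpow_arith_mean_le_arith_mean_rpow univ W (fun ξ => ‖Y ξ‖ ^ p) (fun ξ _ => hW ξ) hW1
      (fun ξ _ => by positivity) hr1).trans (le_of_eq (sum_congr rfl fun ξ _ => ?_))
    rw [← Real.rpow_mul (norm_nonneg _), show p * (2 / p) = ((2 : ℕ) : ℝ) by push_cast; field_simp,
      Real.rpow_natCast]
  have hL0 : 0 ≤ ∑ ξ, W ξ * ‖Y ξ‖ ^ p := sum_nonneg fun ξ _ => mul_nonneg (hW ξ) (by positivity)
  have j2 : ∑ ξ, W ξ * ‖Y ξ‖ ^ p ≤ ‖T‖ ^ p := by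
    have e : ‖T‖ ^ 2 = (‖T‖ ^ p) ^ (2 / p) := by
      rw [← Real.rpow_mul (norm_nonneg _), show p * (2 / p) = ((2 : ℕ) : ℝ) by push_cast; field_simp,
        Real.rpow_natCast]
    rw [← Real.rpow_le_rpow_iff hL0 (by positivity) (show 0 < 2 / p by positivity), ← e]
    exact j1.trans h2
  have hE0 : 0 ≤ cubeAvg (fun δ => ‖Z δ‖) := by
    simp only [cubeAvg, smul_eq_mul]; positivity
  have j3 : (cubeAvg (fun δ => ‖Z δ‖)) ^ p ≤ cubeAvg (fun δ => ‖Z δ‖ ^ p) := by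
    rw [cubeAvg_eq_wE, cubeAvg_eq_wE]
    exact Real.rpow_arith_mean_le_arith_mean_rpow univ _ _
      (fun ξ _ => prod_nonneg fun _ _ => by norm_num [half]) (wE_one _ half_sum)
      (fun ξ _ => norm_nonneg _) hp1
  calc _ ≤ ‖T‖ ^ p := j2
    _ ≤ (κ * cubeAvg (fun δ => ‖Z δ‖)) ^ p := Real.rpow_le_rpow (norm_nonneg _) hTn hp0.le
    _ = κ ^ p * (cubeAvg (fun δ => ‖Z δ‖)) ^ p := Real.mul_rpow hκ0 hE0
    _ ≤ _ := mul_le_mul_of_nonneg_left j3 (by positivity)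

lemma cubeAvg_mono {n : ℕ} {F G : (Fin n → Bool) → ℝ} (h : ∀ ε, F ε ≤ G ε) :
    cubeAvg F ≤ cubeAvg G := by
  simp only [cubeAvg, smul_eq_mul]
  exact mul_le_mul_of_nonneg_left (sum_le_sum fun ε _ => h ε) (by positivity)

open MeasureTheory in
/-- the heat estimate for `L^q(ν)`-valued functions, `1 ≤ q ≤ 2`,
`1 ≤ p ≤ 2`. -/
theorem heat_estimate_Lq_low.{u} (q p : ℝ) (hq1 : 1 ≤ q) (hq2 : q ≤ 2)
    (hp1 : 1 ≤ p) (hp2 : p ≤ 2) [Fact (1 ≤ ENNReal.ofReal q)] :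
    ∃ C : ℝ, ∀ (Ω : Type u) [MeasurableSpace Ω] (ν : Measure Ω)
      (n : ℕ) (t : ℝ), 0 < t →
      ∀ f : Fin n → (Fin n → Bool) → Lp ℝ (ENNReal.ofReal q) ν,
        cubeAvg (fun ε => ‖∑ i, Dop i (heatOp t (f i)) ε‖ ^ p) ≤
          C * (Real.exp (2 * t) - 1) ^ (-(p / 2)) *
            cubeAvg (fun δ : Fin n → Bool => cubeAvg (fun ε =>
              ‖∑ i, rad (δ i) • Dop i (f i) ε‖ ^ p)) := by
  refine ⟨(9 / 5 : ℝ) ^ p, ?_⟩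
  intro Ω _ ν n t ht f
  have hp0 : 0 < p := by linarith
  obtain ⟨ρ, hρ⟩ : ∃ ρ, ρ = Real.exp (-t) := ⟨_, rfl⟩
  have hρ0 : 0 < ρ := hρ ▸ Real.exp_pos _
  have hρ1 : ρ < 1 := by rw [hρ, Real.exp_lt_one_iff]; linarith
  have hρ2 : 0 < 1 - ρ ^ 2 := by nlinarith
  set c := ρ / (1 - ρ ^ 2) with hc
  have hc0 : 0 ≤ c := by positivity
  set σ := Real.sqrt (1 - ρ ^ 2) with hσ
  have hσ0 : 0 < σ := Real.sqrt_pos.2 hρ2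
  have hσ2 : σ ^ 2 = 1 - ρ ^ 2 := Real.sq_sqrt hρ2.le
  have hk0 : ∀ b, 0 ≤ hk ρ b := by intro b; cases b <;> simp [hk, rad] <;> linarith
  set W : (Fin n → Bool) → ℝ := fun ξ => ∏ i, hk ρ (ξ i) with hWdef
  have hW : ∀ ξ, 0 ≤ W ξ := fun ξ => prod_nonneg fun i _ => hk0 _
  have hW1 : ∑ ξ, W ξ = 1 := wE_one _ (hk_sum ρ)
  set Y : (Fin n → Bool) → (Fin n → Bool) → Lp ℝ (ENNReal.ofReal q) ν :=
    fun ξ ε => ∑ i, (rad (ξ i) - ρ) • Dop i (f i) ε with hY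
  have rep : ∀ ε, ∑ i, Dop i (heatOp t (f i)) ε = ∑ ξ, W ξ • (c • Y ξ (xm ε ξ)) := by
    intro ε
    simp only [Dop_heatOp' t ρ hρ hρ2.ne', hY, smul_sum]
    rw [sum_comm]
  have step1 : ∀ ε, ‖∑ i, Dop i (heatOp t (f i)) ε‖ ^ p ≤
      c ^ p * ∑ ξ, W ξ * ‖Y ξ (xm ε ξ)‖ ^ p := by
    intro ε
    rw [rep]
    have a1 : ‖∑ ξ, W ξ • (c • Y ξ (xm ε ξ))‖ ≤ ∑ ξ, W ξ * (c * ‖Y ξ (xm ε ξ)‖) := by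
      refine (norm_sum_le _ _).trans (le_of_eq (sum_congr rfl fun ξ _ => ?_))
      rw [norm_smul, norm_smul, Real.norm_of_nonneg (hW ξ), Real.norm_of_nonneg hc0]
    refine (Real.rpow_le_rpow (norm_nonneg _) a1 hp0.le).trans ?_
    refine (Real.rpow_arith_mean_le_arith_mean_rpow univ W _ (fun ξ _ => hW ξ) hW1
      (fun ξ _ => by positivity) hp1).trans (le_of_eq ?_)
    rw [mul_sum]
    refine sum_congr rfl fun ξ _ => ?_
    rw [Real.mul_rpow hc0 (norm_nonneg _)]; ring
  have step2 : cubeAvg (fun ε => c ^ p * ∑ ξ, W ξ * ‖Y ξ (xm ε ξ)‖ ^ p) =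
      cubeAvg (fun ε => c ^ p * ∑ ξ, W ξ * ‖Y ξ ε‖ ^ p) := by
    simp only [cubeAvg, ← mul_sum]
    congr 2
    rw [sum_comm]
    conv_rhs => rw [sum_comm]
    refine sum_congr rfl fun ξ _ => ?_
    rw [← (xmE ξ).sum_comp (fun ε => W ξ * ‖Y ξ ε‖ ^ p)]
    refine sum_congr rfl fun ε _ => ?_
    rw [xm_comm]; rfl
  have step3 : ∀ ε, c ^ p * ∑ ξ, W ξ * ‖Y ξ ε‖ ^ p ≤
      (c ^ p * (9 / 5 * σ) ^ p) *
        cubeAvg (fun δ : Fin n → Bool => ‖∑ i, rad (δ i) • Dop i (f i) ε‖ ^ p) := by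
    intro ε
    rw [mul_assoc]
    exact mul_le_mul_of_nonneg_left
      (key_Lq q p hq1 hq2 hp1 hp2 ρ hρ0.le hρ1.le (fun i => Dop i (f i) ε)) (by positivity)
  have const : c ^ p * (9 / 5 * σ) ^ p = (9 / 5 : ℝ) ^ p * (Real.exp (2 * t) - 1) ^ (-(p / 2)) := by
    have e1 : Real.exp (2 * t) - 1 = (σ / ρ) ^ 2 := by
      have : Real.exp (2 * t) = (ρ ^ 2)⁻¹ := by
        rw [hρ, ← Real.exp_nat_mul, ← Real.exp_neg]; congr 1; push_cast; ring
      rw [this, div_pow, hσ2]; field_simp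
    have e2 : c * (9 / 5 * σ) = 9 / 5 * (ρ / σ) := by
      rw [hc, ← hσ2]; field_simp
    have e3 : (Real.exp (2 * t) - 1) ^ (-(p / 2)) = (ρ / σ) ^ p := by
      rw [e1, ← Real.rpow_natCast, ← Real.rpow_mul (by positivity),
        show ((2 : ℕ) : ℝ) * (-(p / 2)) = -p by push_cast; ring, Real.rpow_neg (by positivity),
        ← Real.inv_rpow (by positivity), inv_div]
    rw [← Real.mul_rpow hc0 (by positivity), e2, e3, Real.mul_rpow (by norm_num) (by positivity)]
  calc _ ≤ cubeAvg (fun ε => c ^ p * ∑ ξ, W ξ * ‖Y ξ (xm ε ξ)‖ ^ p) := cubeAvg_mono step1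
    _ = cubeAvg (fun ε => c ^ p * ∑ ξ, W ξ * ‖Y ξ ε‖ ^ p) := step2
    _ ≤ _ := cubeAvg_mono step3
    _ = _ := by
      rw [const]
      simp only [cubeAvg, smul_eq_mul, mul_sum]
      rw [sum_comm]
      refine sum_congr rfl fun δ _ => sum_congr rfl fun ε _ => ?_
      ring

end
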